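/- arXiv:2602.18718 — 3 statements merged into one kernel-verified Lean document; each statement's English description precedes it below -/
import Mathlib

section
/- Coercivity of the Bures–Wasserstein gradient of the energy (Lemma 3.7): Let p = N(m_p, Σ_p) and q = N(m_q, Σ_q) be Gaussians with positive-definite covariances, let T_{q→p} be the optimal transport map from q to p, and for a Gaussian r = N(m_r, Σ_r) write G_r(x) = ∫ ∇U dr + (∫ ∇²U dr)(x − m_r) for the Bures–Wasserstein gradient of the energy at r. Then E_{Y∼q}⟨ G_p(T_{q→p}(Y)) − G_q(Y), T_{q→p}(Y) − Y ⟩ ≥ (μ/2) · E_{Y∼q}‖ T_{q→p}(Y) − Y ‖² + ( ∫ U dp − ∫ U dq − E_{Y∼q}⟨ G_q(Y), T_{q→p}(Y) − Y ⟩ ). (The quantity E_{Y∼q}‖T_{q→p}(Y) − Y‖² is the squared Wasserstein-2 distance between p and q, and the parenthesized remainder is the Bures–Wasserstein Bregman divergence of the energy.) -/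
open MeasureTheory Matrix Real
open scoped RealInnerProductSpace

noncomputable section

/-- `ℝ^d` as a Euclidean space. -/
abbrev Vec (d : ℕ) := EuclideanSpace ℝ (Fin d)

/-- `d × d` real matrices. -/
abbrev Mat (d : ℕ) := Matrix (Fin d) (Fin d) ℝ

variable {d : ℕ}

/-- Matrix-vector product as a map on Euclidean space. -/
def matVec (A : Mat d) (x : Vec d) : Vec d :=
  (EuclideanSpace.equiv (Fin d) ℝ).symm (A.mulVec (EuclideanSpace.equiv (Fin d) ℝ x))

/-- The Gaussian measure `N(m, S)` on `ℝ^d` with mean `m` and covariance `S`,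
defined via its density with respect to Lebesgue measure.  (For `S` positive
definite this is the usual Gaussian probability measure.) -/
def gaussian (m : Vec d) (S : Mat d) : Measure (Vec d) :=
  volume.withDensity fun x =>
    ENNReal.ofReal (Real.sqrt (((2 * π) ^ d * S.det)⁻¹) *
      Real.exp (-⟪x - m, matVec S⁻¹ (x - m)⟫ / 2))

/-- The Hessian of `f : ℝ^d → ℝ` at `x`, as a `d × d` matrix. -/
def hess (f : Vec d → ℝ) (x : Vec d) : Mat d :=
  Matrix.of fun i j =>
    fderiv ℝ (fun y => fderiv ℝ f y (EuclideanSpace.single j 1)) x (EuclideanSpace.single i 1)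

/-- Frobenius norm of a matrix. -/
def frobNorm (A : Mat d) : ℝ := Real.sqrt (∑ i, ∑ j, (A i j) ^ 2)

/-- Squared Frobenius norm of a matrix. -/
def frobSq (A : Mat d) : ℝ := ∑ i, ∑ j, (A i j) ^ 2

/-- Jacobian of `g : ℝ^d → ℝ^d` at `x`: `(jacobian g x) i j = ∂ g_j / ∂ x_i`. -/
def jacobian (g : Vec d → Vec d) (x : Vec d) : Mat d :=
  Matrix.of fun i j => fderiv ℝ (fun y => g y j) x (EuclideanSpace.single i 1)

/-- Integral of the gradient of `U` against a measure. -/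
def intGrad (U : Vec d → ℝ) (q : Measure (Vec d)) : Vec d := ∫ x, gradient U x ∂q

/-- Entrywise integral of the Hessian of `U` against a measure. -/
def intHess (U : Vec d → ℝ) (q : Measure (Vec d)) : Mat d :=
  Matrix.of fun i j => ∫ x, hess U x i j ∂q

/-- The variational free energy of the Gaussian `N(m,S)`:
`F(m,Σ) = ∫ U dN(m,Σ) − (1/2)·log((2πe)^d · det Σ)`. -/
def freeEnergy (U : Vec d → ℝ) (m : Vec d) (S : Mat d) : ℝ :=
  (∫ x, U x ∂(gaussian m S)) - (1 / 2) * Real.log ((2 * π * Real.exp 1) ^ d * S.det)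

lemma matVec_eq_toEuclideanCLM (A : Mat d) (x : Vec d) :
    matVec A x = Matrix.toEuclideanCLM (𝕜 := ℝ) A x := rfl

lemma matVec_mul (A B : Mat d) (x : Vec d) : matVec (A * B) x = matVec A (matVec B x) := by
  simp only [matVec_eq_toEuclideanCLM, map_mul, mul_apply_eq_comp]

/-- The density of the standard Gaussian measure. -/
def stdDensity (x : Vec d) : ℝ := Real.sqrt (((2 * π) ^ d)⁻¹) * Real.exp (-‖x‖ ^ 2 / 2)

lemma stdDensity_pos (x : Vec d) : 0 < stdDensity x := by
  unfold stdDensity; positivity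

lemma contDiff_stdDensity : ContDiff ℝ 1 (stdDensity (d := d)) := by
  unfold stdDensity
  exact contDiff_const.mul (((contDiff_norm_sq ℝ).neg.div_const 2).exp)

lemma hasFDerivAt_stdDensity (x : Vec d) :
    HasFDerivAt stdDensity (-(stdDensity x) • innerSL ℝ x) x := by
  have h := (((hasStrictFDerivAt_norm_sq x).hasFDerivAt.const_mul (-(1 / 2) : ℝ)).exp).const_mul
    (Real.sqrt (((2 * π) ^ d)⁻¹))
  have e : (stdDensity : Vec d → ℝ) =
      fun y => Real.sqrt (((2 * π) ^ d)⁻¹) * Real.exp (-(1 / 2) * ‖y‖ ^ 2) := by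
    ext y
    unfold stdDensity
    congr 2
    ring
  rw [e]
  refine h.congr_fderiv ?_
  ext y
  simp
  ring

lemma gaussian_zero_one : gaussian (0 : Vec d) 1 =
    volume.withDensity fun x => ENNReal.ofReal (stdDensity x) := by
  unfold gaussian stdDensity
  congr 1
  ext x
  simp [matVec_eq_toEuclideanCLM]

lemma integral_gaussian_zero_one (f : Vec d → ℝ) :
    ∫ x, f x ∂(gaussian (0 : Vec d) 1) = ∫ x, stdDensity x * f x := by
  rw [gaussian_zero_one, integral_withDensity_eq_integral_toReal_smul
    (contDiff_stdDensity.continuous.measurable.ennreal_ofReal) (by simp)]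
  simp [ENNReal.toReal_ofReal (stdDensity_pos _).le]

lemma integrable_gaussian_zero_one_iff {E : Type*} [NormedAddCommGroup E] [NormedSpace ℝ E]
    (f : Vec d → E) :
    Integrable f (gaussian (0 : Vec d) 1) ↔ Integrable (fun x => stdDensity x • f x) := by
  rw [gaussian_zero_one, integrable_withDensity_iff_integrable_smul'
    (contDiff_stdDensity.continuous.measurable.ennreal_ofReal) (by simp)]
  simp [ENNReal.toReal_ofReal (stdDensity_pos _).le]

lemma integrable_exp_neg_mul_norm_sq {b : ℝ} (hb : 0 < b) :
    Integrable (fun x : Vec d => Real.exp (-b * ‖x‖ ^ 2)) := by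
  apply Integrable.of_integral_ne_zero
  rw [GaussianFourier.integral_rexp_neg_mul_sq_norm hb]
  positivity

lemma integral_stdDensity : ∫ x : Vec d, stdDensity x = 1 := by
  have h := GaussianFourier.integral_rexp_neg_mul_sq_norm (V := Vec d) (b := 1 / 2) (by norm_num)
  have e : ∀ x : Vec d, stdDensity x =
      Real.sqrt (((2 * π) ^ d)⁻¹) * Real.exp (-(1 / 2) * ‖x‖ ^ 2) := fun x => by
    unfold stdDensity; congr 2; ring
  simp_rw [e]
  rw [integral_const_mul, h, finrank_euclideanSpace_fin, Real.sqrt_inv, Real.sqrt_eq_rpow,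
    ← Real.rpow_natCast, ← Real.rpow_mul (by positivity)]
  rw [show π / (1 / 2) = 2 * π by ring, show (d : ℝ) * (1 / 2) = d / 2 by ring]
  exact inv_mul_cancel₀ (by positivity)

instance isProbabilityMeasure_gaussian_zero_one :
    IsProbabilityMeasure (gaussian (0 : Vec d) 1) := by
  constructor
  rw [gaussian_zero_one, withDensity_apply _ MeasurableSet.univ, Measure.restrict_univ,
    ← ofReal_integral_eq_lintegral_ofReal, integral_stdDensity, ENNReal.ofReal_one]
  · refine Integrable.of_integral_ne_zero ?_
    rw [integral_stdDensity]; exact one_ne_zero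
  · exact Filter.Eventually.of_forall fun x => (stdDensity_pos x).le

/-- Continuous functions of at most quadratic growth are integrable for the standard Gaussian. -/
lemma integrable_of_quadratic_growth {E : Type*} [NormedAddCommGroup E] [NormedSpace ℝ E]
    {f : Vec d → E} (hf : Continuous f) {C : ℝ} (h : ∀ x, ‖f x‖ ≤ C * (1 + ‖x‖ ^ 2)) :
    Integrable f (gaussian (0 : Vec d) 1) := by
  rw [integrable_gaussian_zero_one_iff]
  have hC : 0 ≤ C := by simpa using (norm_nonneg _).trans (h 0)
  refine ((integrable_exp_neg_mul_norm_sq (d := d) (b := 1 / 4) (by norm_num)).const_mul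
    (Real.sqrt (((2 * π) ^ d)⁻¹) * (C * 4))).mono'
    (contDiff_stdDensity.continuous.smul hf).aestronglyMeasurable ?_
  refine Filter.Eventually.of_forall fun x => ?_
  rw [norm_smul, Real.norm_of_nonneg (stdDensity_pos x).le]
  have h1 : 1 + ‖x‖ ^ 2 ≤ 4 * Real.exp (‖x‖ ^ 2 / 4) := by
    have := Real.add_one_le_exp (‖x‖ ^ 2 / 4)
    linarith
  have h2 : Real.exp (-‖x‖ ^ 2 / 2) * Real.exp (‖x‖ ^ 2 / 4) =
      Real.exp (-(1 / 4) * ‖x‖ ^ 2) := by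
    rw [← Real.exp_add]; congr 1; ring
  calc stdDensity x * ‖f x‖
      ≤ stdDensity x * (C * (4 * Real.exp (‖x‖ ^ 2 / 4))) :=
        mul_le_mul_of_nonneg_left ((h x).trans (mul_le_mul_of_nonneg_left h1 hC))
          (stdDensity_pos x).le
    _ = _ := by rw [← h2]; unfold stdDensity; ring

/-- A Gaussian measure is an invertible affine image of the standard one. -/
lemma gaussian_eq_map_affine (m : Vec d) {B S : Mat d} (hB : B.det ≠ 0) (hS : B * Bᵀ = S) :
    gaussian m S = (gaussian (0 : Vec d) 1).map fun z => m + matVec B z := by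
  have hBu : IsUnit B.det := isUnit_iff_ne_zero.mpr hB
  have hdet : LinearMap.det (Matrix.toEuclideanCLM (𝕜 := ℝ) B : Vec d →ₗ[ℝ] Vec d) = B.det := by
    rw [Matrix.coe_toEuclideanCLM_eq_toEuclideanLin, Matrix.toEuclideanLin_eq_toLin_orthonormal,
      LinearMap.det_toLin]
  set A : Vec d →L[ℝ] Vec d := Matrix.toEuclideanCLM (𝕜 := ℝ) B with hA
  have hvol : (volume : Measure (Vec d)).map (fun z => m + matVec B z) =
      ENNReal.ofReal |B.det⁻¹| • volume := by
    have h1 := Measure.map_linearMap_addHaar_eq_smul_addHaar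
      (volume : Measure (Vec d)) (f := (A : Vec d →ₗ[ℝ] Vec d)) (by rw [hdet]; exact hB)
    rw [hdet] at h1
    have h2 : (fun z => m + matVec B z) = (fun x => m + x) ∘ (A : Vec d →ₗ[ℝ] Vec d) := rfl
    rw [h2, ← Measure.map_map (measurable_const_add m) (by exact A.continuous.measurable), h1,
      Measure.map_smul, map_add_left_eq_self]
  have hTmeas : Measurable fun z => m + matVec B z :=
    (continuous_const.add A.continuous).measurable
  have hdens : ∀ z : Vec d, Real.sqrt (((2 * π) ^ d * S.det)⁻¹) *
      Real.exp (-⟪m + matVec B z - m, matVec S⁻¹ (m + matVec B z - m)⟫ / 2) =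
      |B.det⁻¹| * stdDensity z := fun z => by
    have h1 : ⟪m + matVec B z - m, matVec S⁻¹ (m + matVec B z - m)⟫ = ‖z‖ ^ 2 := by
      rw [add_sub_cancel_left, ← matVec_mul]
      have h2 : S⁻¹ * B = (B⁻¹)ᵀ := by
        rw [← hS, Matrix.mul_inv_rev, Matrix.mul_assoc, Matrix.nonsing_inv_mul _ hBu,
          Matrix.mul_one, Matrix.transpose_nonsing_inv]
      rw [h2, ← real_inner_self_eq_norm_sq]
      have h3 : matVec (B⁻¹)ᵀ z = ContinuousLinearMap.adjoint
          (Matrix.toEuclideanCLM (𝕜 := ℝ) B⁻¹) z := by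
        rw [matVec_eq_toEuclideanCLM, ← Matrix.conjTranspose_eq_transpose_of_trivial,
          ← Matrix.star_eq_conjTranspose, map_star]
        rfl
      rw [h3, ContinuousLinearMap.adjoint_inner_right, ← matVec_eq_toEuclideanCLM, ← matVec_mul,
        Matrix.nonsing_inv_mul _ hBu]
      simp [matVec_eq_toEuclideanCLM]
    have h4 : S.det = B.det ^ 2 := by rw [← hS, Matrix.det_mul, Matrix.det_transpose, sq]
    rw [h1, h4, stdDensity, mul_inv, Real.sqrt_mul (by positivity), ← inv_pow (det B),
      Real.sqrt_sq_eq_abs]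
    ring
  have hrho : Measurable fun x : Vec d => ENNReal.ofReal (Real.sqrt (((2 * π) ^ d * S.det)⁻¹) *
      Real.exp (-⟪x - m, matVec S⁻¹ (x - m)⟫ / 2)) := by
    simp only [matVec_eq_toEuclideanCLM]
    fun_prop
  ext s hs
  have hc : ENNReal.ofReal |B.det⁻¹| ≠ 0 := by simpa using hB
  have hmul : ENNReal.ofReal |B.det⁻¹| * gaussian m S s =
      ENNReal.ofReal |B.det⁻¹| *
        (gaussian (0 : Vec d) 1).map (fun z => m + matVec B z) s := by
    rw [Measure.map_apply hTmeas hs, gaussian_zero_one, withDensity_apply _ (hTmeas hs),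
      gaussian, withDensity_apply _ hs, ← smul_eq_mul, ← lintegral_smul_measure,
      ← Measure.restrict_smul, ← hvol, setLIntegral_map hs hrho hTmeas,
      ← lintegral_const_mul _ (contDiff_stdDensity.continuous.measurable.ennreal_ofReal)]
    refine lintegral_congr fun z => ?_
    rw [hdens, ENNReal.ofReal_mul (abs_nonneg _)]
  exact (ENNReal.mul_right_inj hc ENNReal.ofReal_ne_top).mp hmul

lemma integral_gaussian_affine (m : Vec d) {B S : Mat d} (hB : B.det ≠ 0) (hS : B * Bᵀ = S)
    {E : Type*} [NormedAddCommGroup E] [NormedSpace ℝ E] {f : Vec d → E} (hf : Continuous f) :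
    ∫ x, f x ∂(gaussian m S) = ∫ z, f (m + matVec B z) ∂(gaussian (0 : Vec d) 1) := by
  rw [gaussian_eq_map_affine m hB hS, integral_map _ hf.aestronglyMeasurable]
  simp only [matVec_eq_toEuclideanCLM]
  fun_prop

lemma norm_le_of_norm_fderiv_le {u : Vec d → ℝ} (hu : ContDiff ℝ 1 u) {C : ℝ}
    (hC : ∀ z, ‖fderiv ℝ u z‖ ≤ C) (z : Vec d) : ‖u z‖ ≤ ‖u 0‖ + C * ‖z‖ := by
  have := Convex.norm_image_sub_le_of_norm_fderiv_le (𝕜 := ℝ) (f := u) (C := C)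
    (fun x _ => hu.differentiable (by norm_num) x) (fun x _ => hC x) convex_univ
    (Set.mem_univ 0) (Set.mem_univ z)
  rw [sub_zero] at this
  linarith [norm_le_norm_add_norm_sub' (u z) (u 0)]

lemma norm_le_one_add_norm_sq (z : Vec d) : ‖z‖ ≤ 1 + ‖z‖ ^ 2 := by
  nlinarith [sq_nonneg (‖z‖ - 1)]

lemma integrable_of_norm_fderiv_le {u : Vec d → ℝ} (hu : ContDiff ℝ 1 u) {C : ℝ}
    (hC : ∀ z, ‖fderiv ℝ u z‖ ≤ C) :
    Integrable u (gaussian (0 : Vec d) 1) := by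
  have hC0 : 0 ≤ C := (norm_nonneg _).trans (hC 0)
  have hgrow := norm_le_of_norm_fderiv_le hu hC
  have hcont := hu.continuous
  exact integrable_of_quadratic_growth hcont (C := ‖u 0‖ + C) fun z => by
      refine (hgrow z).trans ?_
      nlinarith [norm_nonneg (u 0), norm_le_one_add_norm_sq z, sq_nonneg ‖z‖,
        mul_le_mul_of_nonneg_left (norm_le_one_add_norm_sq z) hC0,
        mul_nonneg (norm_nonneg (u 0)) (sq_nonneg ‖z‖)]

lemma integrable_mul_inner_of_norm_fderiv_le {u : Vec d → ℝ} (hu : ContDiff ℝ 1 u) {C : ℝ}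
    (hC : ∀ z, ‖fderiv ℝ u z‖ ≤ C) (v : Vec d) :
    Integrable (fun z => u z * ⟪z, v⟫) (gaussian (0 : Vec d) 1) := by
  have hC0 : 0 ≤ C := (norm_nonneg _).trans (hC 0)
  have hgrow := norm_le_of_norm_fderiv_le hu hC
  have hcont := hu.continuous
  exact integrable_of_quadratic_growth (by fun_prop) (C := (‖u 0‖ + C) * ‖v‖) fun z => by
      rw [norm_mul]
      have h1 : ‖⟪z, v⟫‖ ≤ ‖z‖ * ‖v‖ := norm_inner_le_norm z v
      calc ‖u z‖ * ‖⟪z, v⟫‖ ≤ (‖u 0‖ + C * ‖z‖) * (‖z‖ * ‖v‖) := by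
            gcongr
            exact hgrow z
        _ = (‖u 0‖ * ‖z‖ + C * ‖z‖ ^ 2) * ‖v‖ := by ring
        _ ≤ (‖u 0‖ * (1 + ‖z‖ ^ 2) + C * (1 + ‖z‖ ^ 2)) * ‖v‖ := by
            gcongr
            · exact norm_le_one_add_norm_sq z
            · linarith
        _ = _ := by ring

/-- Stein's identity for the standard Gaussian. -/
lemma integral_mul_inner_gaussian {u : Vec d → ℝ} (hu : ContDiff ℝ 1 u) {C : ℝ}
    (hC : ∀ z, ‖fderiv ℝ u z‖ ≤ C) (v : Vec d) :
    ∫ z, u z * ⟪z, v⟫ ∂(gaussian (0 : Vec d) 1) = ∫ z, fderiv ℝ u z v ∂(gaussian (0 : Vec d) 1) := by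
  have hC0 : 0 ≤ C := (norm_nonneg _).trans (hC 0)
  have hcont' := hu.continuous_fderiv (by norm_num)
  have i1 := integrable_of_norm_fderiv_le hu hC
  have i2 := integrable_mul_inner_of_norm_fderiv_le hu hC v
  have i3 : Integrable (fun z => fderiv ℝ u z v) (gaussian (0 : Vec d) 1) :=
    integrable_of_quadratic_growth (by fun_prop) (C := C * ‖v‖) fun z => by
      refine ((fderiv ℝ u z).le_opNorm v).trans ?_
      have := mul_le_mul_of_nonneg_right (hC z) (norm_nonneg v)
      nlinarith [sq_nonneg ‖z‖, mul_nonneg hC0 (norm_nonneg v),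
        mul_nonneg (mul_nonneg hC0 (norm_nonneg v)) (sq_nonneg ‖z‖)]
  rw [integrable_gaussian_zero_one_iff] at i1 i2 i3
  have hd : ∀ z : Vec d, fderiv ℝ stdDensity z v = -(stdDensity z * ⟪z, v⟫) := fun z => by
    rw [(hasFDerivAt_stdDensity z).fderiv]; simp
  have key := integral_mul_fderiv_eq_neg_fderiv_mul_of_integrable (μ := (volume : Measure (Vec d)))
    (f := u) (g := stdDensity) (v := v)
    (by simpa [mul_comm] using i3)
    (by simp_rw [hd]; refine i2.neg.congr (Filter.Eventually.of_forall fun z => ?_); simp; ring)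
    (by simpa [mul_comm] using i1)
    (fun x _ => hu.differentiable (by norm_num) x)
    (fun x _ => (hasFDerivAt_stdDensity x).differentiableAt)
  rw [integral_gaussian_zero_one, integral_gaussian_zero_one]
  simp_rw [hd] at key
  rw [← neg_inj, ← integral_neg]
  refine Eq.trans ?_ (key.trans ?_)
  · congr 1; ext z; ring
  · simp only [mul_comm]

lemma abs_apply_le_of_posSemidef {H : Mat d} {μ L : ℝ} (hμ : 0 ≤ μ)
    (h1 : (H - μ • 1).PosSemidef) (h2 : (L • (1 : Mat d) - H).PosSemidef) (i j : Fin d) :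
    |H i j| ≤ L := by
  have hH : H.PosSemidef := by
    have := h1.add (Matrix.PosSemidef.one.smul hμ)
    simpa using this
  have hdiag : ∀ k, H k k ≤ L := fun k => by
    have := h2.diag_nonneg (i := k)
    simpa using this
  have hsymm : H j i = H i j := by simpa using hH.isHermitian.apply i j
  have hquad : ∀ s : ℝ, 0 ≤ H i i + s * (H i j + H j i) + s ^ 2 * H j j := fun s => by
    have h := hH.dotProduct_mulVec_nonneg (Pi.single i 1 + s • Pi.single j 1)
    simp [Matrix.mulVec_add, Matrix.mulVec_smul] at h
    linarith
  have hp := hquad 1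
  have hn := hquad (-1)
  rw [hsymm] at hp hn
  exact abs_le.mpr ⟨by linarith [hdiag i, hdiag j], by linarith [hdiag i, hdiag j]⟩

section Potential

variable {U : Vec d → ℝ} {μ L : ℝ}

lemma contDiff_fderiv_apply (hU : ContDiff ℝ 2 U) (v : Vec d) :
    ContDiff ℝ 1 fun y => fderiv ℝ U y v :=
  (hU.fderiv_right (m := 1) (by norm_num)).clm_apply contDiff_const

lemma vec_eq_sum_smul_single (v : Vec d) :
    v = ∑ i, v i • (EuclideanSpace.single i (1 : ℝ) : Vec d) := by
  conv_lhs => rw [← (EuclideanSpace.basisFun (Fin d) ℝ).sum_repr v]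
  simp [EuclideanSpace.basisFun_repr, EuclideanSpace.basisFun_apply]

lemma fderiv_fderiv_apply_single (x v : Vec d) (j : Fin d) :
    fderiv ℝ (fun y => fderiv ℝ U y (EuclideanSpace.single j 1)) x v =
      ∑ i, v i * hess U x i j := by
  conv_lhs => rw [vec_eq_sum_smul_single v, map_sum]
  simp [hess]

lemma gradient_apply (x : Vec d) (i : Fin d) :
    gradient U x i = fderiv ℝ U x (EuclideanSpace.single i 1) := by
  have h : ⟪gradient U x, EuclideanSpace.single i 1⟫ = fderiv ℝ U x (EuclideanSpace.single i 1) := by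
    simp [gradient]
  rw [← h, EuclideanSpace.inner_single_right]
  simp

lemma inner_gradient (x v : Vec d) : ⟪gradient U x, v⟫ = fderiv ℝ U x v := by
  simp [gradient]

lemma contDiff_gradient_apply (hU : ContDiff ℝ 2 U) (i : Fin d) :
    ContDiff ℝ 1 fun x => gradient U x i := by
  simp only [gradient_apply]
  exact contDiff_fderiv_apply hU _

lemma fderiv_gradient_apply (x v : Vec d) (j : Fin d) :
    fderiv ℝ (fun y => gradient U y j) x v = ∑ i, v i * hess U x i j := by
  simp only [gradient_apply]
  exact fderiv_fderiv_apply_single x v j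

lemma continuous_gradient (hU : ContDiff ℝ 2 U) : Continuous (gradient U) := by
  unfold gradient
  exact (InnerProductSpace.toDual ℝ (Vec d)).symm.continuous.comp
    (hU.continuous_fderiv (by norm_num))

lemma continuous_hess_apply (hU : ContDiff ℝ 2 U) (i j : Fin d) :
    Continuous fun x => hess U x i j := by
  simp only [hess, Matrix.of_apply]
  exact ((contDiff_fderiv_apply hU _).continuous_fderiv (by norm_num)).clm_apply continuous_const

lemma hess_symm (hconv : ∀ x, (hess U x - μ • 1).PosSemidef) (x : Vec d) (i j : Fin d) :
    hess U x i j = hess U x j i := by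
  have h := (hconv x).isHermitian
  have h2 : (hess U x).IsHermitian := by
    have := h.add ((Matrix.isHermitian_one (n := Fin d) (α := ℝ)).smul (k := μ)
      (by simp [IsSelfAdjoint]))
    simpa using this
  simpa using (h2.apply i j).symm

lemma norm_fderiv_gradient_apply_le (hess_le : ∀ x i j, |hess U x i j| ≤ L) (x : Vec d)
    (j : Fin d) : ‖fderiv ℝ (fun y => gradient U y j) x‖ ≤ d * L := by
  have hL : 0 ≤ L := (abs_nonneg _).trans (hess_le x j j)
  refine ContinuousLinearMap.opNorm_le_bound _ (by positivity) fun v => ?_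
  rw [fderiv_gradient_apply]
  calc ‖∑ i, v i * hess U x i j‖ ≤ ∑ i, ‖v i * hess U x i j‖ := norm_sum_le _ _
    _ ≤ ∑ i : Fin d, ‖v‖ * L := by
        refine Finset.sum_le_sum fun i _ => ?_
        rw [norm_mul]
        exact mul_le_mul (PiLp.norm_apply_le v i) (hess_le x i j) (norm_nonneg _) (norm_nonneg _)
    _ = d * L * ‖v‖ := by simp; ring

lemma norm_le_sum_abs (v : Vec d) : ‖v‖ ≤ ∑ i, |v i| := by
  conv_lhs => rw [vec_eq_sum_smul_single v]
  refine (norm_sum_le _ _).trans (le_of_eq ?_)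
  simp [norm_smul]

lemma exists_norm_gradient_le (hU : ContDiff ℝ 2 U) (hess_le : ∀ x i j, |hess U x i j| ≤ L) :
    ∃ C, 0 ≤ C ∧ ∀ x, ‖gradient U x‖ ≤ C * (1 + ‖x‖) := by
  refine ⟨∑ i : Fin d, (|gradient U 0 i| + |d * L|), by positivity, fun x => ?_⟩
  refine (norm_le_sum_abs _).trans ?_
  rw [Finset.sum_mul]
  refine Finset.sum_le_sum fun i _ => ?_
  have h := norm_le_of_norm_fderiv_le (contDiff_gradient_apply hU i)
    (fun z => norm_fderiv_gradient_apply_le hess_le z i) x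
  rw [Real.norm_eq_abs, Real.norm_eq_abs] at h
  nlinarith [norm_nonneg x, abs_nonneg (gradient U 0 i), abs_nonneg (d * L), le_abs_self (d * L),
    mul_le_mul_of_nonneg_right (le_abs_self (d * L)) (norm_nonneg x),
    mul_nonneg (abs_nonneg (gradient U 0 i)) (norm_nonneg x)]

lemma strong_convexity (hU : ContDiff ℝ 2 U) (hconv : ∀ x, (hess U x - μ • 1).PosSemidef)
    (x y : Vec d) : U x + ⟪gradient U x, y - x⟫ + μ / 2 * ‖y - x‖ ^ 2 ≤ U y := by
  set v := y - x with hv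
  have hline : ∀ t : ℝ, HasDerivAt (fun t : ℝ => x + t • v) v t := fun t => by
    simpa using ((hasDerivAt_id t).smul_const v).const_add x
  have hφ : ∀ t : ℝ, HasDerivAt (fun t : ℝ => U (x + t • v)) (fderiv ℝ U (x + t • v) v) t :=
    fun t => ((hU.differentiable (by norm_num) _).hasFDerivAt).comp_hasDerivAt t (hline t)
  have hsum : ∀ z, fderiv ℝ U z v = ∑ j, v j * fderiv ℝ U z (EuclideanSpace.single j 1) :=
    fun z => by
      conv_lhs => rw [vec_eq_sum_smul_single v, map_sum]
      simp
  have hφ' : ∀ t : ℝ, HasDerivAt (fun t : ℝ => fderiv ℝ U (x + t • v) v)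
      (∑ j, v j * ∑ i, v i * hess U (x + t • v) i j) t := fun t => by
    simp only [hsum]
    refine HasDerivAt.fun_sum fun j _ => HasDerivAt.const_mul _ ?_
    have := (((contDiff_fderiv_apply hU (EuclideanSpace.single j 1)).differentiable
      (by norm_num) (x + t • v)).hasFDerivAt).comp_hasDerivAt t (hline t)
    rwa [fderiv_fderiv_apply_single] at this
  have hg : ∀ t : ℝ, HasDerivAt (fun t : ℝ => U (x + t • v) - μ / 2 * ‖v‖ ^ 2 * t ^ 2)
      (fderiv ℝ U (x + t • v) v - μ * ‖v‖ ^ 2 * t) t := fun t => by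
    have := (hφ t).sub ((hasDerivAt_pow 2 t).const_mul (μ / 2 * ‖v‖ ^ 2))
    refine this.congr_deriv ?_
    simp; ring
  have hg' : ∀ t : ℝ, HasDerivAt (fun t : ℝ => fderiv ℝ U (x + t • v) v - μ * ‖v‖ ^ 2 * t)
      ((∑ j, v j * ∑ i, v i * hess U (x + t • v) i j) - μ * ‖v‖ ^ 2) t := fun t => by
    have := (hφ' t).sub ((hasDerivAt_id t).const_mul (μ * ‖v‖ ^ 2))
    exact this.congr_deriv (by simp)
  have hpos : ∀ t : ℝ, 0 ≤ (∑ j, v j * ∑ i, v i * hess U (x + t • v) i j) - μ * ‖v‖ ^ 2 := by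
    intro t
    have h := (hconv (x + t • v)).dotProduct_mulVec_nonneg (v : Fin d → ℝ)
    have e : ‖v‖ ^ 2 = ∑ i, v i * v i := by
      rw [EuclideanSpace.real_norm_sq_eq]; simp [sq]
    rw [Matrix.sub_mulVec, Matrix.smul_mulVec, Matrix.one_mulVec, dotProduct_sub] at h
    simp only [star_trivial, dotProduct_smul, smul_eq_mul] at h
    rw [e]
    refine h.trans (le_of_eq ?_)
    congr 1
    simp only [dotProduct, Matrix.mulVec]
    refine Finset.sum_congr rfl fun j _ => ?_
    congr 1
    refine Finset.sum_congr rfl fun i _ => ?_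
    rw [hess_symm hconv _ j i, mul_comm]
  have hderiv : deriv (fun t : ℝ => U (x + t • v) - μ / 2 * ‖v‖ ^ 2 * t ^ 2) =
      fun t => fderiv ℝ U (x + t • v) v - μ * ‖v‖ ^ 2 * t := funext fun t => (hg t).deriv
  have hmono : Monotone fun t : ℝ => fderiv ℝ U (x + t • v) v - μ * ‖v‖ ^ 2 * t :=
    monotone_of_deriv_nonneg (fun t => (hg' t).differentiableAt) fun t => by
      rw [(hg' t).deriv]; exact hpos t
  have hcvx := Monotone.convexOn_univ_of_deriv (fun t => (hg t).differentiableAt)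
    (by rw [hderiv]; exact hmono)
  have h := hcvx.le_slope_of_hasDerivAt (Set.mem_univ 0) (Set.mem_univ 1) zero_lt_one (hg 0)
  rw [slope_def_field] at h
  have e : x + v = y := by rw [hv]; abel
  rw [inner_gradient]
  simp [e] at h
  linarith

end Potential

/-- A map whose value and Jacobian have zero mean under the standard Gaussian is orthogonal
to every affine map. -/
lemma integral_inner_affine_eq_zero {W : Vec d → Vec d} (hW : ∀ i, ContDiff ℝ 1 fun z => W z i)
    {C : ℝ} (hC : ∀ i z, ‖fderiv ℝ (fun z => W z i) z‖ ≤ C)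
    (h0 : ∀ i, ∫ z, W z i ∂(gaussian (0 : Vec d) 1) = 0)
    (h1 : ∀ i v, ∫ z, fderiv ℝ (fun z => W z i) z v ∂(gaussian (0 : Vec d) 1) = 0)
    (c : Vec d) (M : Mat d) :
    ∫ z, ⟪W z, c + matVec M z⟫ ∂(gaussian (0 : Vec d) 1) = 0 := by
  have hrow : ∀ i (z : Vec d), (matVec M z) i = ⟪z, WithLp.toLp 2 (M i)⟫ := fun i z => by
    simp [matVec, Matrix.mulVec, PiLp.inner_apply, dotProduct]
  have hexp : ∀ z, ⟪W z, c + matVec M z⟫ =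
      ∑ i, (c i * W z i + W z i * ⟪z, WithLp.toLp 2 (M i)⟫) := fun z => by
    rw [PiLp.inner_apply]
    refine Finset.sum_congr rfl fun i _ => ?_
    rw [← hrow]
    simp
    ring
  have hi1 : ∀ i, Integrable (fun z => c i * W z i) (gaussian (0 : Vec d) 1) := fun i =>
    (integrable_of_norm_fderiv_le (hW i) (hC i)).const_mul _
  have hi2 : ∀ i, Integrable (fun z => W z i * ⟪z, WithLp.toLp 2 (M i)⟫)
      (gaussian (0 : Vec d) 1) := fun i => integrable_mul_inner_of_norm_fderiv_le (hW i) (hC i) _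
  simp_rw [hexp]
  rw [integral_finsetSum _ (by intro i _; exact (hi1 i).add (hi2 i))]
  refine Finset.sum_eq_zero fun i _ => ?_
  rw [integral_add (hi1 i) (hi2 i), integral_const_mul, h0,
    integral_mul_inner_gaussian (hW i) (hC i), h1]
  simp

/-- Continuous vector fields of at most linear growth. -/
def HasLinearGrowth (F : Vec d → Vec d) : Prop :=
  Continuous F ∧ ∃ C, 0 ≤ C ∧ ∀ z, ‖F z‖ ≤ C * (1 + ‖z‖)

lemma hasLinearGrowth_affine (m : Vec d) (B : Mat d) :
    HasLinearGrowth fun z => m + matVec B z := by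
  simp only [matVec_eq_toEuclideanCLM]
  refine ⟨by fun_prop, ‖m‖ + ‖Matrix.toEuclideanCLM (𝕜 := ℝ) B‖, by positivity, fun z => ?_⟩
  refine (norm_add_le _ _).trans ?_
  have := (Matrix.toEuclideanCLM (𝕜 := ℝ) B).le_opNorm z
  nlinarith [norm_nonneg m, norm_nonneg z, norm_nonneg (Matrix.toEuclideanCLM (𝕜 := ℝ) B),
    mul_nonneg (norm_nonneg m) (norm_nonneg z)]

lemma HasLinearGrowth.comp {F G : Vec d → Vec d} (hF : HasLinearGrowth F)
    (hG : HasLinearGrowth G) : HasLinearGrowth fun z => F (G z) := by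
  obtain ⟨hFc, C, hC, hF⟩ := hF
  obtain ⟨hGc, D, hD, hG⟩ := hG
  refine ⟨hFc.comp hGc, C * (1 + D), by positivity, fun z => ?_⟩
  calc ‖F (G z)‖ ≤ C * (1 + ‖G z‖) := hF _
    _ ≤ C * (1 + D * (1 + ‖z‖)) := by gcongr; exact hG z
    _ ≤ C * (1 + D) * (1 + ‖z‖) := by
        nlinarith [mul_nonneg hC (norm_nonneg z)]

lemma HasLinearGrowth.sub {F G : Vec d → Vec d} (hF : HasLinearGrowth F)
    (hG : HasLinearGrowth G) : HasLinearGrowth fun z => F z - G z := by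
  obtain ⟨hFc, C, hC, hF⟩ := hF
  obtain ⟨hGc, D, hD, hG⟩ := hG
  refine ⟨hFc.sub hGc, C + D, by positivity, fun z => (norm_sub_le _ _).trans ?_⟩
  linarith [hF z, hG z]

lemma HasLinearGrowth.integrable {F : Vec d → Vec d} (hF : HasLinearGrowth F) :
    Integrable F (gaussian (0 : Vec d) 1) := by
  obtain ⟨hFc, C, hC, hF⟩ := hF
  refine integrable_of_quadratic_growth hFc (C := 2 * C) fun z => (hF z).trans ?_
  nlinarith [mul_nonneg hC (sq_nonneg (‖z‖ - 1)), mul_nonneg hC (sq_nonneg ‖z‖)]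

lemma HasLinearGrowth.integrable_inner {F G : Vec d → Vec d} (hF : HasLinearGrowth F)
    (hG : HasLinearGrowth G) : Integrable (fun z => ⟪F z, G z⟫) (gaussian (0 : Vec d) 1) := by
  obtain ⟨hFc, C, hC, hF⟩ := hF
  obtain ⟨hGc, D, hD, hG⟩ := hG
  refine integrable_of_quadratic_growth (hFc.inner hGc) (C := 2 * (C * D)) fun z => ?_
  calc ‖⟪F z, G z⟫‖ ≤ ‖F z‖ * ‖G z‖ := norm_inner_le_norm _ _
    _ ≤ (C * (1 + ‖z‖)) * (D * (1 + ‖z‖)) :=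
        mul_le_mul (hF z) (hG z) (norm_nonneg _) (by positivity)
    _ ≤ _ := by nlinarith [mul_nonneg (mul_nonneg hC hD) (sq_nonneg (‖z‖ - 1))]

section Potential

variable {U : Vec d → ℝ} {μ L : ℝ}

lemma hasLinearGrowth_gradient (hU : ContDiff ℝ 2 U) (hess_le : ∀ x i j, |hess U x i j| ≤ L) :
    HasLinearGrowth (gradient U) :=
  ⟨continuous_gradient hU, exists_norm_gradient_le hU hess_le⟩

lemma integrable_comp_affine (hU : ContDiff ℝ 2 U) (hess_le : ∀ x i j, |hess U x i j| ≤ L)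
    (hμ : 0 ≤ μ) (hconv : ∀ x, (hess U x - μ • 1).PosSemidef) (m : Vec d) (B : Mat d) :
    Integrable (fun z => U (m + matVec B z)) (gaussian (0 : Vec d) 1) := by
  have haff := hasLinearGrowth_affine m B
  have hg := hasLinearGrowth_gradient hU hess_le
  have hc : HasLinearGrowth fun _ : Vec d => gradient U 0 := by
    simpa [matVec_eq_toEuclideanCLM] using hasLinearGrowth_affine (gradient U 0) (0 : Mat d)
  refine integrable_of_le_of_le (hU.continuous.comp haff.1).aestronglyMeasurable
    (g₁ := fun z => U 0 + ⟪gradient U 0, m + matVec B z⟫)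
    (g₂ := fun z => U 0 + ⟪gradient U (m + matVec B z), m + matVec B z⟫)
    (Filter.Eventually.of_forall fun z => ?_) (Filter.Eventually.of_forall fun z => ?_)
    ((integrable_const _).add (hc.integrable_inner haff))
    ((integrable_const _).add ((hg.comp haff).integrable_inner haff))
  · have := strong_convexity hU hconv 0 (m + matVec B z)
    rw [sub_zero] at this
    have h0 : 0 ≤ μ / 2 * ‖m + matVec B z‖ ^ 2 := by positivity
    dsimp only
    linarith
  · have := strong_convexity hU hconv (m + matVec B z) 0
    rw [zero_sub, inner_neg_right] at this
    have h0 : 0 ≤ μ / 2 * ‖-(m + matVec B z)‖ ^ 2 := by positivity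
    dsimp only
    linarith

/-- Against affine maps, the Bures–Wasserstein gradient of the energy at a Gaussian may be
replaced by the Euclidean gradient of the potential. -/
lemma integral_inner_bwGradient (hU : ContDiff ℝ 2 U) (hess_le : ∀ x i j, |hess U x i j| ≤ L)
    (hconv : ∀ x, (hess U x - μ • 1).PosSemidef) (m : Vec d) {B S : Mat d} (hB : B.det ≠ 0)
    (hS : B * Bᵀ = S) (c : Vec d) (M : Mat d) :
    ∫ z, ⟪intGrad U (gaussian m S) + matVec (intHess U (gaussian m S)) (matVec B z),
        c + matVec M z⟫ ∂(gaussian (0 : Vec d) 1) =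
      ∫ z, ⟪gradient U (m + matVec B z), c + matVec M z⟫ ∂(gaussian (0 : Vec d) 1) := by
  set g := intGrad U (gaussian m S) with hg
  set H := intHess U (gaussian m S) with hH
  have haff := hasLinearGrowth_affine m B
  have hD := hasLinearGrowth_affine c M
  have hgrad := (hasLinearGrowth_gradient hU hess_le).comp haff
  have hbw : HasLinearGrowth fun z => g + matVec H (matVec B z) := by
    simpa only [matVec_mul] using hasLinearGrowth_affine g (H * B)
  have hgi : ∀ i, g i = ∫ z, gradient U (m + matVec B z) i ∂(gaussian (0 : Vec d) 1) := fun i => by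
    rw [hg, intGrad, integral_gaussian_affine m hB hS (continuous_gradient hU)]
    exact ((EuclideanSpace.proj (𝕜 := ℝ) i).integral_comp_comm hgrad.integrable).symm
  have hHij : ∀ i j, H i j = ∫ z, hess U (m + matVec B z) i j ∂(gaussian (0 : Vec d) 1) :=
    fun i j => by
      rw [hH, intHess, Matrix.of_apply,
        integral_gaussian_affine m hB hS (continuous_hess_apply hU i j)]
  have hHint : ∀ i j, Integrable (fun z => hess U (m + matVec B z) i j)
      (gaussian (0 : Vec d) 1) := fun i j =>
    integrable_of_quadratic_growth ((continuous_hess_apply hU i j).comp haff.1) (C := L) fun z => by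
      have h := hess_le (m + matVec B z) i j
      have hL := (abs_nonneg _).trans h
      rw [Real.norm_eq_abs]
      nlinarith [mul_nonneg hL (sq_nonneg ‖z‖)]
  have hHsymm : ∀ i j, H i j = H j i := fun i j => by
    rw [hHij, hHij]; simp_rw [hess_symm hconv _ i j]
  set A : Vec d →L[ℝ] Vec d := Matrix.toEuclideanCLM (𝕜 := ℝ) B with hA
  set K : Vec d →L[ℝ] Vec d := Matrix.toEuclideanCLM (𝕜 := ℝ) H with hK
  have hrow : ∀ (w : Vec d) i, K w i = ∑ j, w j * H j i := fun w i => by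
    rw [hK, ← matVec_eq_toEuclideanCLM]
    simp only [matVec, Matrix.mulVec, dotProduct, EuclideanSpace.equiv,
      PiLp.coe_symm_continuousLinearEquiv, PiLp.coe_continuousLinearEquiv]
    exact Finset.sum_congr rfl fun j _ => by rw [hHsymm i j, mul_comm]
  set W : Vec d → Vec d := fun z => gradient U (m + A z) - (g + K (A z)) with hW
  have hWfd : ∀ i z, HasFDerivAt (fun z => W z i)
      ((fderiv ℝ (fun y => gradient U y i) (m + A z)).comp A -
        (EuclideanSpace.proj i).comp (K.comp A)) z := fun i z => by
    have h1 := ((contDiff_gradient_apply hU i).differentiable (by norm_num)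
      (m + A z)).hasFDerivAt.comp z (A.hasFDerivAt.const_add m)
    have h2 := (((EuclideanSpace.proj (𝕜 := ℝ) i).comp
      (K.comp A)).hasFDerivAt (x := z)).const_add (g i)
    exact h1.sub h2
  have hWsmooth : ∀ i, ContDiff ℝ 1 fun z => W z i := fun i => by
    have h1 := (contDiff_gradient_apply hU i).comp ((contDiff_const (c := m)).add A.contDiff)
    have h2 := (contDiff_const (n := 1) (c := g i)).add
      ((EuclideanSpace.proj (𝕜 := ℝ) i).comp (K.comp A)).contDiff
    exact h1.sub h2
  have hWbound : ∀ i z, ‖fderiv ℝ (fun z => W z i) z‖ ≤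
      d * L * ‖A‖ + ∑ i : Fin d, ‖(EuclideanSpace.proj (𝕜 := ℝ) i).comp (K.comp A)‖ :=
    fun i z => by
      rw [(hWfd i z).fderiv]
      refine (norm_sub_le _ _).trans (add_le_add ?_ ?_)
      · exact (ContinuousLinearMap.opNorm_comp_le _ _).trans (mul_le_mul_of_nonneg_right
          (norm_fderiv_gradient_apply_le hess_le _ i) (norm_nonneg _))
      · exact Finset.single_le_sum
          (f := fun i => ‖(EuclideanSpace.proj (𝕜 := ℝ) i).comp (K.comp A)‖)
          (fun _ _ => norm_nonneg _) (Finset.mem_univ i)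
  have hlin : ∀ i, ∫ z, K (A z) i ∂(gaussian (0 : Vec d) 1) = 0 := fun i => by
    have h := integral_mul_inner_gaussian (u := fun _ : Vec d => (1 : ℝ)) contDiff_const (C := 0)
      (by simp) (ContinuousLinearMap.adjoint (K.comp A) (EuclideanSpace.single i 1))
    simp only [ContinuousLinearMap.adjoint_inner_right, EuclideanSpace.inner_single_right] at h
    simpa using h
  have hW0 : ∀ i, ∫ z, W z i ∂(gaussian (0 : Vec d) 1) = 0 := fun i => by
    have e : (fun z => W z i) = fun z => gradient U (m + matVec B z) i - (g i + K (A z) i) := rfl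
    have i1 : Integrable (fun z => gradient U (m + matVec B z) i) (gaussian (0 : Vec d) 1) :=
      (EuclideanSpace.proj (𝕜 := ℝ) i).integrable_comp hgrad.integrable
    have i2 : Integrable (fun z => K (A z) i) (gaussian (0 : Vec d) 1) := by
      have := (hasLinearGrowth_affine 0 (H * B)).integrable
      simp only [zero_add, matVec_mul] at this
      exact (EuclideanSpace.proj (𝕜 := ℝ) i).integrable_comp this
    have i3 : Integrable (fun z => g i + K (A z) i) (gaussian (0 : Vec d) 1) :=
      (integrable_const _).add i2
    rw [e, integral_sub i1 i3, integral_add (integrable_const _) i2, hlin, ← hgi]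
    simp
  have hW1 : ∀ i v, ∫ z, fderiv ℝ (fun z => W z i) z v ∂(gaussian (0 : Vec d) 1) = 0 :=
    fun i v => by
      have e : ∀ z, fderiv ℝ (fun z => W z i) z v =
          (∑ k, A v k * hess U (m + matVec B z) k i) - K (A v) i := fun z => by
        rw [(hWfd i z).fderiv, ← fderiv_gradient_apply]
        rfl
      simp_rw [e]
      rw [integral_sub (integrable_finsetSum _ fun k _ => (hHint k i).const_mul _)
        (integrable_const _), integral_finsetSum _ fun k _ => (hHint k i).const_mul _, hrow]
      simp_rw [integral_const_mul, ← hHij]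
      simp
  have key := integral_inner_affine_eq_zero hWsmooth hWbound hW0 hW1 c M
  have e : ∀ z, ⟪W z, c + matVec M z⟫ = ⟪gradient U (m + matVec B z), c + matVec M z⟫ -
      ⟪g + matVec H (matVec B z), c + matVec M z⟫ := fun z => inner_sub_left _ _ _
  simp_rw [e] at key
  rw [integral_sub (hgrad.integrable_inner hD) (hbw.integrable_inner hD)] at key
  linarith

end Potential

/-- **Coercivity of the Bures–Wasserstein gradient of the energy** (Lemma 3.7).
Let `p = N(m_p, Σ_p)`, `q = N(m_q, Σ_q)`, let `Q = Σ_q^{1/2}` (the unique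
positive-definite square root) and `R = (Σ_q^{1/2} Σ_p Σ_q^{1/2})^{1/2}` (the
unique positive-semidefinite square root), so that
`T_{q→p}(y) = m_p + Q⁻¹ R Q⁻¹ (y − m_q)` is the optimal transport map from `q`
to `p`, and write `G_r(x) = ∫∇U dr + (∫∇²U dr)(x − m_r)` for the
Bures–Wasserstein gradient of the energy at a Gaussian `r`.  Then
`E_{Y∼q}⟨G_p(T(Y)) − G_q(Y), T(Y) − Y⟩ ≥ (μ/2)·E‖T(Y) − Y‖²
   + (∫U dp − ∫U dq − E⟨G_q(Y), T(Y) − Y⟩)`. -/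
theorem bw_gradient_coercivity
    (d : ℕ) (hd : 0 < d) (U : Vec d → ℝ) (μ L : ℝ) (hμ : 0 < μ) (hμL : μ ≤ L)
    (hU : ContDiff ℝ 2 U)
    (hconv : ∀ x : Vec d,
      (hess U x - μ • 1).PosSemidef ∧ ((L • (1 : Mat d)) - hess U x).PosSemidef)
    (mp mq : Vec d) (Sp Sq : Mat d) (hSp : Sp.PosDef) (hSq : Sq.PosDef)
    (Q : Mat d) (hQ : Q.PosDef) (hQ2 : Q * Q = Sq)
    (R : Mat d) (hR : R.PosSemidef) (hR2 : R * R = Q * Sp * Q) :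
    let T : Vec d → Vec d := fun y => mp + matVec (Q⁻¹ * R * Q⁻¹) (y - mq)
    let Gp : Vec d → Vec d := fun x =>
      intGrad U (gaussian mp Sp) + matVec (intHess U (gaussian mp Sp)) (x - mp)
    let Gq : Vec d → Vec d := fun y =>
      intGrad U (gaussian mq Sq) + matVec (intHess U (gaussian mq Sq)) (y - mq)
    (∫ y, ⟪Gp (T y) - Gq y, T y - y⟫ ∂(gaussian mq Sq))
      ≥ (μ / 2) * (∫ y, ‖T y - y‖ ^ 2 ∂(gaussian mq Sq))
        + ((∫ x, U x ∂(gaussian mp Sp)) - (∫ x, U x ∂(gaussian mq Sq))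
            - ∫ y, ⟪Gq y, T y - y⟫ ∂(gaussian mq Sq)) := by
  intro T Gp Gq
  have hconv₁ : ∀ x, (hess U x - μ • 1).PosSemidef := fun x => (hconv x).1
  have hess_le : ∀ x i j, |hess U x i j| ≤ L := fun x i j =>
    abs_apply_le_of_posSemidef hμ.le (hconv x).1 (hconv x).2 i j
  have hQdet : Q.det ≠ 0 := hQ.det_pos.ne'
  have hQu : IsUnit Q.det := isUnit_iff_ne_zero.mpr hQdet
  have hQt : Qᵀ = Q := by simpa using hQ.isHermitian.eq
  have hRt : Rᵀ = R := by simpa using hR.isHermitian.eq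
  have hRdet : R.det ≠ 0 := fun h => by
    have h1 := congrArg Matrix.det hR2
    rw [Matrix.det_mul, Matrix.det_mul, Matrix.det_mul, h, zero_mul] at h1
    exact mul_ne_zero (mul_ne_zero hQdet hSp.det_pos.ne') hQdet h1.symm
  have hQS : Q * Qᵀ = Sq := by rw [hQt, hQ2]
  set B : Mat d := Q⁻¹ * R with hBdef
  have hBdet : B.det ≠ 0 := by
    rw [hBdef, Matrix.det_mul, Matrix.det_nonsing_inv]
    exact mul_ne_zero (by simpa using hQdet) hRdet
  have hBS : B * Bᵀ = Sp := by
    rw [hBdef, Matrix.transpose_mul, hRt, Matrix.transpose_nonsing_inv, hQt]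
    calc Q⁻¹ * R * (R * Q⁻¹) = Q⁻¹ * (R * R) * Q⁻¹ := by simp only [Matrix.mul_assoc]
      _ = (Q⁻¹ * Q) * Sp * (Q * Q⁻¹) := by rw [hR2]; simp only [Matrix.mul_assoc]
      _ = Sp := by rw [Matrix.nonsing_inv_mul _ hQu, Matrix.mul_nonsing_inv _ hQu]; simp
  have hT : ∀ z, T (mq + matVec Q z) = mp + matVec B z := fun z => by
    simp only [T]
    rw [add_sub_cancel_left, ← matVec_mul, Matrix.mul_assoc, Matrix.nonsing_inv_mul _ hQu,
      Matrix.mul_one]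
  have hTsub : ∀ z, T (mq + matVec Q z) - (mq + matVec Q z) =
      (mp - mq) + matVec (B - Q) z := fun z => by
    rw [hT]
    simp only [matVec_eq_toEuclideanCLM, map_sub, _root_.sub_apply]
    abel
  have hGp : ∀ z, Gp (T (mq + matVec Q z)) = intGrad U (gaussian mp Sp) +
      matVec (intHess U (gaussian mp Sp)) (matVec B z) := fun z => by
    simp only [Gp, hT, add_sub_cancel_left]
  have hTc : Continuous T := by
    simp only [T, matVec_eq_toEuclideanCLM]; fun_prop
  have hGpc : Continuous Gp := by
    simp only [Gp, matVec_eq_toEuclideanCLM]; fun_prop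
  have hGqc : Continuous Gq := by
    simp only [Gq, matVec_eq_toEuclideanCLM]; fun_prop
  have hGpg : HasLinearGrowth fun z => Gp (T (mq + matVec Q z)) := by
    simp only [hGp, ← matVec_mul]
    exact hasLinearGrowth_affine _ _
  have hGqg : HasLinearGrowth fun z => Gq (mq + matVec Q z) := by
    simp only [Gq, add_sub_cancel_left, ← matVec_mul]
    exact hasLinearGrowth_affine _ _
  have hDg : HasLinearGrowth fun z => T (mq + matVec Q z) - (mq + matVec Q z) := by
    simp only [hTsub]
    exact hasLinearGrowth_affine _ _
  have hgradg := (hasLinearGrowth_gradient hU hess_le).comp (hasLinearGrowth_affine mp B)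
  rw [integral_gaussian_affine mq hQdet hQS hU.continuous,
    integral_gaussian_affine mp hBdet hBS hU.continuous,
    integral_gaussian_affine mq hQdet hQS (by fun_prop),
    integral_gaussian_affine mq hQdet hQS (by fun_prop),
    integral_gaussian_affine mq hQdet hQS (by fun_prop)]
  simp_rw [inner_sub_left]
  rw [integral_sub (hGpg.integrable_inner hDg) (hGqg.integrable_inner hDg)]
  have hstein : ∫ z, ⟪Gp (T (mq + matVec Q z)), T (mq + matVec Q z) - (mq + matVec Q z)⟫
        ∂(gaussian (0 : Vec d) 1) =
      ∫ z, ⟪gradient U (mp + matVec B z), T (mq + matVec Q z) - (mq + matVec Q z)⟫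
        ∂(gaussian (0 : Vec d) 1) := by
    simp_rw [hGp, hTsub]
    exact integral_inner_bwGradient hU hess_le hconv₁ mp hBdet hBS _ _
  have iUp := integrable_comp_affine hU hess_le hμ.le hconv₁ mp B
  have iUq := integrable_comp_affine hU hess_le hμ.le hconv₁ mq Q
  have iUsub : Integrable (fun z => U (mp + matVec B z) - U (mq + matVec Q z))
      (gaussian (0 : Vec d) 1) := iUp.sub iUq
  have inorm : Integrable (fun z => ‖T (mq + matVec Q z) - (mq + matVec Q z)‖ ^ 2)
      (gaussian (0 : Vec d) 1) := by
    simpa only [real_inner_self_eq_norm_sq] using hDg.integrable_inner hDg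
  have hmono : ∫ z, (μ / 2 * ‖T (mq + matVec Q z) - (mq + matVec Q z)‖ ^ 2 +
        (U (mp + matVec B z) - U (mq + matVec Q z))) ∂(gaussian (0 : Vec d) 1) ≤
      ∫ z, ⟪gradient U (mp + matVec B z), T (mq + matVec Q z) - (mq + matVec Q z)⟫
        ∂(gaussian (0 : Vec d) 1) := by
    refine integral_mono ((inorm.const_mul _).add iUsub) (hgradg.integrable_inner hDg)
      fun z => ?_
    have h := strong_convexity hU hconv₁ (mp + matVec B z) (mq + matVec Q z)
    dsimp only
    rw [hT]
    rw [← neg_sub (mp + matVec B z), inner_neg_right, norm_neg] at h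
    linarith
  rw [integral_add (inorm.const_mul _) iUsub, integral_const_mul,
    integral_sub iUp iUq] at hmono
  linarith
end
end

section
/- Lyapunov decrease under the decreasing step-size schedule: Let μ > 0, b ≥ 0, τ > 0, and let t_* ≤ T be nonnegative integers. Let (V_t)_{t_* ≤ t ≤ T} be reals satisfying, for every t with t_* ≤ t < T, V_{t+1} ≤ (1 − μγ_t)·V_t + b·γ_t², where γ_t = (1/μ)·(2(t+τ)+1)/(t+τ+1)². Then V_T ≤ ((t_* + τ)² / (T + τ)²)·V_{t_*} + (4b/μ²)·(T − t_*)/(T + τ)². -/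
/-- One step of the recursion, multiplied by `(x + 1) ^ 2`, where `x` is the shifted time. -/
lemma sq_mul_le_of_lyapunov_step {μ b x v w : ℝ} (hμ : 0 < μ) (hb : 0 ≤ b) (hx : 0 < x)
    (h : w ≤ (1 - μ * ((1 / μ) * (2 * x + 1) / (x + 1) ^ 2)) * v
      + b * ((1 / μ) * (2 * x + 1) / (x + 1) ^ 2) ^ 2) :
    (x + 1) ^ 2 * w ≤ x ^ 2 * v + 4 * b / μ ^ 2 := by
  have hratio : ((2 * x + 1) / (x + 1)) ^ 2 ≤ 4 := by
    rw [div_pow, div_le_iff₀ (by positivity)]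
    nlinarith
  calc (x + 1) ^ 2 * w
      ≤ (x + 1) ^ 2 * ((1 - μ * ((1 / μ) * (2 * x + 1) / (x + 1) ^ 2)) * v
          + b * ((1 / μ) * (2 * x + 1) / (x + 1) ^ 2) ^ 2) := by gcongr
    _ = x ^ 2 * v + b / μ ^ 2 * ((2 * x + 1) / (x + 1)) ^ 2 := by
      field_simp
      ring
    _ ≤ x ^ 2 * v + b / μ ^ 2 * 4 := by gcongr
    _ = x ^ 2 * v + 4 * b / μ ^ 2 := by ring

/-- **Lyapunov decrease under the decreasing step-size schedule** (Lemma C.7).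
If `V_{t+1} ≤ (1 − μγ_t)V_t + bγ_t²` for `t_* ≤ t < T` with
`γ_t = (1/μ)·(2(t+τ)+1)/(t+τ+1)²`, `μ > 0`, `b ≥ 0` and `τ > 0`, then
`V_T ≤ ((t_*+τ)²/(T+τ)²)·V_{t_*} + (4b/μ²)·(T−t_*)/(T+τ)²`. -/
theorem lyapunov_decreasing_step
    (μ b τ : ℝ) (hμ : 0 < μ) (hb : 0 ≤ b) (hτ : 0 < τ)
    (tstar T : ℕ) (hle : tstar ≤ T) (V : ℕ → ℝ)
    (hrec : ∀ t : ℕ, tstar ≤ t → t < T →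
      V (t + 1) ≤ (1 - μ * ((1 / μ) * (2 * ((t : ℝ) + τ) + 1) / (((t : ℝ) + τ + 1) ^ 2))) * V t
        + b * ((1 / μ) * (2 * ((t : ℝ) + τ) + 1) / (((t : ℝ) + τ + 1) ^ 2)) ^ 2) :
    V T ≤ (((tstar : ℝ) + τ) ^ 2 / ((T : ℝ) + τ) ^ 2) * V tstar
      + (4 * b / μ ^ 2) * (((T : ℝ) - (tstar : ℝ)) / ((T : ℝ) + τ) ^ 2) := by
  have key : ∀ n : ℕ, tstar ≤ n → n ≤ T → ((n : ℝ) + τ) ^ 2 * V n ≤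
      ((tstar : ℝ) + τ) ^ 2 * V tstar + 4 * b / μ ^ 2 * ((n : ℝ) - tstar) := by
    intro n hn
    induction n, hn using Nat.le_induction with
    | base => simp
    | succ n hn ih =>
      intro hnT
      have hstep := sq_mul_le_of_lyapunov_step hμ hb (by positivity) (hrec n hn hnT)
      have hprev := ih (by omega)
      push_cast
      rw [add_right_comm (n : ℝ) 1 τ]
      linarith
  have hpos : 0 < ((T : ℝ) + τ) ^ 2 := by positivity
  calc V T ≤ (((tstar : ℝ) + τ) ^ 2 * V tstar + 4 * b / μ ^ 2 * ((T : ℝ) - tstar))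
        / ((T : ℝ) + τ) ^ 2 := by
        rw [le_div_iff₀' hpos]
        exact key T hle le_rfl
    _ = _ := by ring
end

section
/- Lyapunov convergence under the two-stage step-size schedule: Let μ > 0, b > 0, and γ₀ > 0 with 0 < μγ₀ < 1, and let (V_t)_{t≥0} be nonnegative reals with V_0 > 0 and μ·V_0 ≥ γ₀·b. Set ρ = 1 − μγ₀, t_* = ⌈ log( μV_0 / (γ₀ b) ) / log(1/ρ) ⌉, τ = t_* + 2/(γ₀μ), and define the step sizes γ_t = γ₀ for t < t_* and γ_t = (1/μ)·(2(t+τ)+1)/(t+τ+1)² for t ≥ t_*. Assume V_{t+1} ≤ (1 − μγ_t)·V_t + b·γ_t² for all t ≥ 0. Then for every ε > 0 and every nonnegative integer T with T ≥ max{ B_var, B_bias }, it holds that V_T ≤ ε, where B_var = (4b/μ)·(1/(με)) + (4√b/√μ)·(1/√(μγ₀))·( log(μV_0/(bγ₀)) + μγ₀ + √2 )·(1/√(με)) and B_bias = (1/(μγ₀))·log(2V_0/ε). -/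
/-- Constant step-size recursion: geometric decay of the bias down to the noise floor `a`. -/
theorem le_geometric_add_of_recursion {a : ℝ} (ha0 : 0 < a) (ha1 : a < 1) {W : ℕ → ℝ} {n : ℕ}
    (hW : ∀ t < n, W (t + 1) ≤ (1 - a) * W t + a ^ 2) :
    ∀ t ≤ n, W t ≤ (1 - a) ^ t * W 0 + a := by
  intro t
  induction t with
  | zero => intro _; simp [ha0.le]
  | succ t ih =>
    intro ht
    have h := mul_le_mul_of_nonneg_left (ih (by omega)) (sub_nonneg.2 ha1.le)
    calc W (t + 1) ≤ (1 - a) * W t + a ^ 2 := hW t (by omega)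
      _ ≤ (1 - a) * ((1 - a) ^ t * W 0 + a) + a ^ 2 := by linarith
      _ = (1 - a) ^ (t + 1) * W 0 + a := by ring

/-- Decreasing step-size recursion: the weighted sequence `(t + τ)² W t` grows at most linearly. -/
theorem sq_mul_le_of_recursion {τ : ℝ} (hτ : 0 ≤ τ) {W : ℕ → ℝ} {n : ℕ}
    (hW : ∀ t ≥ n, W (t + 1) ≤ (1 - (2 * (t + τ) + 1) / (t + τ + 1) ^ 2) * W t +
      ((2 * (t + τ) + 1) / (t + τ + 1) ^ 2) ^ 2) :
    ∀ t ≥ n, (t + τ) ^ 2 * W t ≤ (n + τ) ^ 2 * W n + 4 * (t - n) := by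
  intro t ht
  induction t, ht using Nat.le_induction with
  | base => simp
  | succ t ht ih =>
    have hs : 0 ≤ (t : ℝ) + τ := by positivity
    have h := hW t ht
    push_cast
    set s : ℝ := t + τ
    have hs1 : 0 < s + 1 := by positivity
    have hnoise : ((2 * s + 1) / (s + 1)) ^ 2 ≤ 4 := by
      have h2 : (2 * s + 1) / (s + 1) ≤ 2 := by rw [div_le_iff₀ hs1]; linarith
      have h0 : 0 ≤ (2 * s + 1) / (s + 1) := by positivity
      nlinarith
    have h1 : (s + 1) ^ 2 * W (t + 1) ≤ s ^ 2 * W t + ((2 * s + 1) / (s + 1)) ^ 2 := by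
      refine (mul_le_mul_of_nonneg_left h (sq_nonneg (s + 1))).trans_eq ?_
      field_simp
      ring
    rw [show (t : ℝ) + 1 + τ = s + 1 by simp only [s]; ring]
    linarith

/-- The dimensionless form of the two-stage convergence bound, with `a = μγ₀` and the noise
constant scaled to one. -/
theorem two_stage_convergence_of_normalized {a e k : ℝ} (ha0 : 0 < a) (ha1 : a < 1) (he : 0 < e)
    (hk : 0 < k) (hkae : k ^ 2 * (a * e) = 1) {W : ℕ → ℝ} (hW0 : a ≤ W 0) {n : ℕ}
    (hn : n = ⌈Real.log (W 0 / a) / Real.log (1 / (1 - a))⌉₊)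
    (hconst : ∀ t < n, W (t + 1) ≤ (1 - a) * W t + a ^ 2)
    (hdecr : ∀ t ≥ n, W (t + 1) ≤
      (1 - (2 * (t + (n + 2 / a)) + 1) / (t + (n + 2 / a) + 1) ^ 2) * W t +
      ((2 * (t + (n + 2 / a)) + 1) / (t + (n + 2 / a) + 1) ^ 2) ^ 2)
    {T : ℕ} (hvar : 4 / e + 4 * k * (Real.log (W 0 / a) + a + √2) ≤ T)
    (hbias : 1 / a * Real.log (2 * W 0 / e) ≤ T) : W T ≤ e := by
  have hW0pos : 0 < W 0 := ha0.trans_le hW0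
  have hρ : 0 < 1 - a := sub_pos.2 ha1
  have hlogρ : a ≤ Real.log (1 / (1 - a)) := by
    rw [one_div, Real.log_inv]
    linarith [Real.log_le_sub_one_of_pos hρ]
  have hlogρ0 : 0 < Real.log (1 / (1 - a)) := ha0.trans_le hlogρ
  have hL : 0 ≤ Real.log (W 0 / a) := Real.log_nonneg ((one_le_div ha0).2 hW0)
  have hlogpow (t : ℕ) : Real.log ((1 - a) ^ t * W 0 / a) =
      Real.log (W 0 / a) - t * Real.log (1 / (1 - a)) := by
    rw [mul_div_assoc, Real.log_mul (by positivity) (by positivity), Real.log_pow, one_div,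
      Real.log_inv]
    ring
  have hgeom := le_geometric_add_of_recursion ha0 ha1 hconst
  rcases lt_or_ge T n with hT | hT
  · have hfloor : a ≤ (1 - a) ^ T * W 0 := by
      rw [hn, Nat.lt_ceil, lt_div_iff₀ hlogρ0] at hT
      rw [← one_le_div ha0, ← Real.log_nonneg_iff (by positivity), hlogpow]
      linarith
    have hdecay : (1 - a) ^ T * W 0 ≤ e / 2 := by
      have h1 : (1 - a) ^ T ≤ Real.exp (-(a * T)) := by
        calc (1 - a) ^ T ≤ Real.exp (-a) ^ T :=
              pow_le_pow_left₀ hρ.le (Real.one_sub_le_exp_neg a) T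
          _ = Real.exp (-(a * T)) := by rw [← Real.exp_nat_mul]; congr 1; ring
      have h2 : 2 * W 0 / e ≤ Real.exp (a * T) := by
        rw [← Real.log_le_iff_le_exp (by positivity)]
        rw [one_div_mul_eq_div, div_le_iff₀ ha0] at hbias
        linarith
      rw [div_le_iff₀ he] at h2
      rw [Real.exp_neg] at h1
      calc (1 - a) ^ T * W 0 ≤ (Real.exp (a * T))⁻¹ * W 0 :=
            mul_le_mul_of_nonneg_right h1 hW0pos.le
        _ ≤ e / 2 := by
            rw [inv_mul_le_iff₀ (Real.exp_pos _)]
            linarith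
    linarith [hgeom T hT.le]
  · have hWn : W n ≤ 2 * a := by
      have h1 : (1 - a) ^ n * W 0 ≤ a := by
        have h2 := Nat.le_ceil (Real.log (W 0 / a) / Real.log (1 / (1 - a)))
        rw [← hn, div_le_iff₀ hlogρ0] at h2
        rw [← div_le_one ha0, ← Real.log_nonpos_iff (by positivity), hlogpow]
        linarith
      linarith [hgeom n le_rfl]
    have hweighted := sq_mul_le_of_recursion (by positivity) hdecr T hT
    set L := Real.log (W 0 / a)
    have hna : n * a ≤ L + a := by
      have h1 := Nat.ceil_lt_add_one (div_nonneg hL hlogρ0.le)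
      rw [← hn] at h1
      have h2 : L / Real.log (1 / (1 - a)) ≤ L / a := div_le_div_of_nonneg_left hL ha0 hlogρ
      calc n * a ≤ (L / a + 1) * a := by gcongr; linarith
        _ = L + a := by field_simp
    have hsqrt1 : 1 ≤ √2 := Real.one_le_sqrt.2 (by norm_num)
    set X := 4 * k * (L + a + √2) with hX
    set Y := 4 / e with hY
    have hX0 : 0 < X := by positivity
    have hY0 : 0 < Y := by positivity
    have hT0 : (0 : ℝ) < T := by linarith
    have hYe : Y * e = 4 := by rw [hY]; field_simp
    have hinit : (n + (n + 2 / a)) ^ 2 * W n ≤ X ^ 2 * e := by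
      calc ((n : ℝ) + (n + 2 / a)) ^ 2 * W n ≤ (n + (n + 2 / a)) ^ 2 * (2 * a) := by gcongr
        _ = 8 * (n * a + 1) ^ 2 / a := by field_simp; ring
        _ ≤ 16 * (L + a + √2) ^ 2 / a := by
            gcongr
            norm_num
        _ = X ^ 2 * e := by
            rw [hX, div_eq_iff ha0.ne']
            linear_combination (-16 * (L + a + √2) ^ 2) * hkae
    have hbound : X ^ 2 * e + 4 * (T - n) ≤ (T + (n + 2 / a)) ^ 2 * e := by
      have h1 : X ^ 2 + Y * T ≤ (T : ℝ) ^ 2 := by nlinarith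
      have h2 : (T : ℝ) ^ 2 ≤ (T + (n + 2 / a)) ^ 2 := by
        gcongr
        linarith [show (0 : ℝ) ≤ n + 2 / a by positivity]
      have h3 := mul_le_mul_of_nonneg_right (h1.trans h2) he.le
      have h4 : (0 : ℝ) ≤ n := n.cast_nonneg
      have h5 : Y * T * e = 4 * T := by linear_combination (T : ℝ) * hYe
      linarith
    exact le_of_mul_le_mul_left (hweighted.trans ((by linarith : _ ≤ _).trans hbound))
      (by positivity)

/-- **Lyapunov convergence under the two-stage step-size schedule**
(Proposition C.5).  Suppose `μ > 0`, `b > 0`, `0 < μγ₀ < 1`, `V₀ > 0`,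
`μV₀ ≥ γ₀b`, and set `ρ = 1 − μγ₀`,
`t_* = ⌈log(μV₀/(γ₀b)) / log(1/ρ)⌉`, `τ = t_* + 2/(γ₀μ)`, with step sizes
`γ_t = γ₀` for `t < t_*` and `γ_t = (1/μ)(2(t+τ)+1)/(t+τ+1)²` for `t ≥ t_*`.
If `V_{t+1} ≤ (1 − μγ_t)V_t + bγ_t²` for all `t`, then for every `ε > 0` and
every `T ≥ max{B_var, B_bias}` one has `V_T ≤ ε`. -/
theorem lyapunov_two_stage_convergence
    (μ b γ0 : ℝ) (hμ : 0 < μ) (hb : 0 < b) (hγ0 : 0 < γ0) (hμγ : μ * γ0 < 1)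
    (V : ℕ → ℝ) (hVnn : ∀ t, 0 ≤ V t) (hV0 : 0 < V 0) (hV0b : γ0 * b ≤ μ * V 0) :
    let ρ : ℝ := 1 - μ * γ0
    let tstar : ℕ := ⌈Real.log (μ * V 0 / (γ0 * b)) / Real.log (1 / ρ)⌉₊
    let τ : ℝ := (tstar : ℝ) + 2 / (γ0 * μ)
    let γ : ℕ → ℝ := fun t =>
      if t < tstar then γ0
      else (1 / μ) * (2 * ((t : ℝ) + τ) + 1) / (((t : ℝ) + τ + 1) ^ 2)
    (∀ t : ℕ, V (t + 1) ≤ (1 - μ * γ t) * V t + b * γ t ^ 2) →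
    ∀ ε : ℝ, 0 < ε → ∀ T : ℕ,
      (T : ℝ) ≥ max
        ((4 * b / μ) * (1 / (μ * ε)) +
          (4 * Real.sqrt b / Real.sqrt μ) * (1 / Real.sqrt (μ * γ0)) *
            (Real.log (μ * V 0 / (b * γ0)) + μ * γ0 + Real.sqrt 2) *
            (1 / Real.sqrt (μ * ε)))
        ((1 / (μ * γ0)) * Real.log (2 * V 0 / ε)) →
      V T ≤ ε := by
  intro ρ tstar τ γ hrec ε hε T hT
  have hc : 0 < μ ^ 2 / b := by positivity
  have hratio : μ ^ 2 / b * V 0 / (μ * γ0) = μ * V 0 / (γ0 * b) := by field_simp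
  have hstep (t : ℕ) : μ ^ 2 / b * V (t + 1) ≤
      (1 - μ * γ t) * (μ ^ 2 / b * V t) + (μ * γ t) ^ 2 := by
    refine (mul_le_mul_of_nonneg_left (hrec t) hc.le).trans_eq ?_
    field_simp
  obtain ⟨hvar, hbias⟩ := max_le_iff.1 hT
  refine le_of_mul_le_mul_left (two_stage_convergence_of_normalized (a := μ * γ0)
    (e := μ ^ 2 / b * ε) (k := √b / √μ * (1 / √(μ * γ0)) * (1 / √(μ * ε)))
    (W := fun t => μ ^ 2 / b * V t) (n := tstar) (by positivity) hμγ (by positivity)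
    (by positivity) ?_ ?_ ?_ ?_ ?_ ?_ ?_) hc
  · simp only [mul_pow, div_pow, one_pow, Real.sq_sqrt hb.le, Real.sq_sqrt hμ.le,
      Real.sq_sqrt (mul_pos hμ hγ0).le, Real.sq_sqrt (mul_pos hμ hε).le]
    field_simp
  · rw [div_mul_eq_mul_div, le_div_iff₀ hb]
    nlinarith
  · simp only [hratio, tstar, ρ]
  · intro t ht
    simpa only [γ, if_pos ht] using hstep t
  · intro t ht
    have hγt : μ * γ t = (2 * (t + (tstar + 2 / (μ * γ0))) + 1) /
        (t + (tstar + 2 / (μ * γ0)) + 1) ^ 2 := by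
      simp only [γ, if_neg (not_lt.2 ht), τ, mul_comm γ0 μ]
      rw [mul_div_assoc, ← mul_assoc, mul_one_div_cancel hμ.ne', one_mul]
    rw [← hγt]
    exact hstep t
  · refine le_of_eq_of_le ?_ hvar
    rw [hratio, mul_comm γ0 b]
    congr 1
    · field_simp
    · ring
  · refine le_of_eq_of_le ?_ hbias
    congr 2
    field_simp
end
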